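/- Assume moreover that 𝒞 is a generator for 𝒢(𝒞)^{⊥1}. Let 0→L→M→N→0 be a short exact sequence in 𝒜 which remains exact after applying Hom_𝒜(C,−) for every C∈𝒞, such that both L and M admit special 𝒢(𝒞)-precovers, and such that there exists a short exact sequence 0→K→C→N→0 in 𝒜 with C∈𝒞 which also remains exact after applying Hom_𝒜(C',−) for every C'∈𝒞. Then N admits a special 𝒢(𝒞)-precover. -/

import Mathlib

open CategoryTheory CategoryTheory.Limits CategoryTheory.Abelian ZeroObject

universe w t v u

variable {A : Type u} [Category.{v} A] [Abelian A]

/-- `f`, `g` form a short exact sequence `0 ⟶ X ⟶ Y ⟶ Z ⟶ 0` in `A`. -/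
def IsSES {X Y Z : A} (f : X ⟶ Y) (g : Y ⟶ Z) : Prop :=
  ∃ hw : f ≫ g = 0, (ShortComplex.mk f g hw).ShortExact

/-- The short exact sequence `0 ⟶ X ⟶ Y ⟶ Z ⟶ 0` remains exact after applying
`Hom_A(C, -)` for every `C` in `𝒞`. -/
def HomLeftExact (𝒞 : A → Prop) {X Y Z : A} (f : X ⟶ Y) (g : Y ⟶ Z) : Prop :=
  ∀ ⦃C : A⦄, 𝒞 C →
    Function.Injective (fun h : C ⟶ X => h ≫ f) ∧
    Function.Exact (fun h : C ⟶ X => h ≫ f) (fun h : C ⟶ Y => h ≫ g) ∧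
    Function.Surjective (fun h : C ⟶ Y => h ≫ g)

/-- The short exact sequence `0 ⟶ X ⟶ Y ⟶ Z ⟶ 0` remains exact after applying
`Hom_A(-, C)` for every `C` in `𝒞`. -/
def HomRightExact (𝒞 : A → Prop) {X Y Z : A} (f : X ⟶ Y) (g : Y ⟶ Z) : Prop :=
  ∀ ⦃C : A⦄, 𝒞 C →
    Function.Injective (fun h : Z ⟶ C => g ≫ h) ∧
    Function.Exact (fun h : Z ⟶ C => g ≫ h) (fun h : Y ⟶ C => f ≫ h) ∧
    Function.Surjective (fun h : Y ⟶ C => f ≫ h)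

/-- `M` belongs to the Gorenstein subcategory `𝒢(𝒞)`: there is an exact sequence
`⋯ ⟶ C_1 ⟶ C_0 ⟶ C^0 ⟶ C^1 ⟶ ⋯` with all terms in `𝒞`, which remains exact after
applying `Hom_A(C,-)` and `Hom_A(-,C)` for every `C ∈ 𝒞`, such that
`M ≅ Im(C_0 ⟶ C^0)`. -/
def IsGorenstein (𝒞 : A → Prop) (M : A) : Prop :=
  ∃ (X : ℤ → A) (d : ∀ n : ℤ, X n ⟶ X (n + 1)) (hw : ∀ n, d n ≫ d (n + 1) = 0),
    (∀ n, 𝒞 (X n)) ∧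
    (∀ n, (ShortComplex.mk (d n) (d (n + 1)) (hw n)).Exact) ∧
    (∀ (n : ℤ) ⦃C : A⦄, 𝒞 C →
      Function.Exact (fun h : C ⟶ X n => h ≫ d n) (fun h : C ⟶ X (n + 1) => h ≫ d (n + 1))) ∧
    (∀ (n : ℤ) ⦃C : A⦄, 𝒞 C →
      Function.Exact (fun h : X (n + 1 + 1) ⟶ C => d (n + 1) ≫ h)
        (fun h : X (n + 1) ⟶ C => d n ≫ h)) ∧
    Nonempty (M ≅ Limits.image (d 0))

/-- `𝒞` is a full additive subcategory closed under isomorphisms, encoded as a predicate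
closed under isomorphisms, containing a zero object and closed under binary biproducts. -/
def IsAdditiveClosed (𝒞 : A → Prop) : Prop :=
  (∀ ⦃X Y : A⦄, (X ≅ Y) → 𝒞 X → 𝒞 Y) ∧ 𝒞 (0 : A) ∧ ∀ ⦃X Y : A⦄, 𝒞 X → 𝒞 Y → 𝒞 (X ⊞ Y)

/-- `𝒫(A)` is a generator for `𝒞`: for every `C ∈ 𝒞` there is a short exact sequence
`0 ⟶ C' ⟶ P ⟶ C ⟶ 0` with `P` projective and `C' ∈ 𝒞`. -/
def ProjIsGeneratorFor (𝒞 : A → Prop) : Prop :=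
  ∀ ⦃C : A⦄, 𝒞 C → ∃ (C' P : A) (f : C' ⟶ P) (g : P ⟶ C),
    Projective P ∧ 𝒞 C' ∧ IsSES f g

section Ext

variable [HasExt.{w} A]

/-- `𝒞` is self-orthogonal: `Ext^i(C, C') = 0` for all `i ≥ 1` and `C, C' ∈ 𝒞`. -/
def SelfOrthogonal (𝒞 : A → Prop) : Prop :=
  ∀ ⦃C C' : A⦄, 𝒞 C → 𝒞 C' → ∀ i : ℕ, 1 ≤ i → Subsingleton (Abelian.Ext C C' i)

/-- `M ∈ 𝒢(𝒞)^{⊥1}`, i.e. `Ext^1(G, M) = 0` for every `G ∈ 𝒢(𝒞)`. -/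
def RightPerp1 (𝒞 : A → Prop) (M : A) : Prop :=
  ∀ ⦃G : A⦄, IsGorenstein 𝒞 G → Subsingleton (Abelian.Ext G M 1)

/-- `f : G ⟶ M` is a special `𝒢(𝒞)`-precover of `M`. -/
def IsSpecialPrecover (𝒞 : A → Prop) {G M : A} (f : G ⟶ M) : Prop :=
  IsGorenstein 𝒞 G ∧ Epi f ∧ RightPerp1 𝒞 (kernel f) ∧
    ∀ ⦃G' : A⦄, IsGorenstein 𝒞 G' → Function.Surjective (fun h : G' ⟶ G => h ≫ f)

/-- `M` belongs to the special precovered category `spc(𝒢(𝒞))`. -/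
def HasSpecialPrecover (𝒞 : A → Prop) (M : A) : Prop :=
  ∃ (G : A) (f : G ⟶ M), IsSpecialPrecover 𝒞 f

/-- `𝒞` is a generator for `𝒢(𝒞)^{⊥1}`. -/
def GeneratorForPerp (𝒞 : A → Prop) : Prop :=
  ∀ ⦃T : A⦄, RightPerp1 𝒞 T → ∃ (T' C : A) (f : T' ⟶ C) (g : C ⟶ T),
    𝒞 C ∧ RightPerp1 𝒞 T' ∧ IsSES f g

end Ext

namespace IsSES

variable {X Y Z : A} {f : X ⟶ Y} {g : Y ⟶ Z}

lemma w (h : IsSES f g) : f ≫ g = 0 := h.1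

lemma mono (h : IsSES f g) : Mono f := h.2.mono_f

lemma epi (h : IsSES f g) : Epi g := h.2.epi_g

lemma exists_lift (h : IsSES f g) {T : A} (k : T ⟶ Y) (hk : k ≫ g = 0) :
    ∃ l : T ⟶ X, l ≫ f = k := by
  have := h.mono
  have : Mono (ShortComplex.mk f g h.w).f := this
  exact ⟨h.2.exact.lift k hk, h.2.exact.lift_f k hk⟩

lemma exists_desc (h : IsSES f g) {T : A} (k : Y ⟶ T) (hk : f ≫ k = 0) :
    ∃ l : Z ⟶ T, g ≫ l = k := by
  have := h.epi
  have : Epi (ShortComplex.mk f g h.w).g := this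
  exact ⟨h.2.exact.desc k hk, h.2.exact.g_desc k hk⟩

lemma of_exists_lift [Mono f] [Epi g] (w : f ≫ g = 0)
    (h : ∀ ⦃T : A⦄ (k : T ⟶ Y), k ≫ g = 0 → ∃ l : T ⟶ X, l ≫ f = k) : IsSES f g := by
  refine ⟨w, ShortComplex.ShortExact.mk' (ShortComplex.exact_of_f_is_kernel _ ?_) ‹_› ‹_›⟩
  exact KernelFork.IsLimit.ofι' f w fun k hk => ⟨(h k hk).choose, (h k hk).choose_spec⟩

lemma op (h : IsSES f g) : IsSES g.op f.op := ⟨_, h.2.op⟩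

lemma unop {X Y Z : Aᵒᵖ} {f : X ⟶ Y} {g : Y ⟶ Z} (h : IsSES f g) : IsSES g.unop f.unop :=
  ⟨_, h.2.unop⟩

lemma of_epi (p : X ⟶ Y) [Epi p] : IsSES (kernel.ι p) p :=
  of_exists_lift (kernel.condition p) fun _ k hk => ⟨kernel.lift p k hk, kernel.lift_ι _ _ _⟩

lemma of_mono (i : X ⟶ Y) [Mono i] : IsSES i (cokernel.π i) :=
  (ShortComplex.ShortExact.mk' (S := ShortComplex.mk i (cokernel.π i) (cokernel.condition i))
    (ShortComplex.exact_of_g_is_cokernel _ (cokernelIsCokernel i)) ‹_› inferInstance) |>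
    fun h => ⟨_, h⟩

lemma biprod (X Y : A) : IsSES (biprod.inl : X ⟶ X ⊞ Y) biprod.snd :=
  of_exists_lift (by simp) fun T k hk => ⟨k ≫ biprod.fst, by ext <;> simp [hk]⟩

lemma id_right (X : A) : IsSES (0 : 0 ⟶ X) (𝟙 X) :=
  have : Mono (0 : 0 ⟶ X) := ⟨fun _ _ _ => (isZero_zero A).eq_of_tgt _ _⟩
  of_exists_lift (by simp) fun _ k hk => ⟨0, by simpa using hk.symm⟩

section Snake

variable {K₁ K₂ K₃ X₁ X₂ X₃ Z₁ Z₂ Z₃ : A}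
  {k₁ : K₁ ⟶ X₁} {k₂ : K₂ ⟶ X₂} {k₃ : K₃ ⟶ X₃} {φ₁ : X₁ ⟶ Z₁} {φ₂ : X₂ ⟶ Z₂} {φ₃ : X₃ ⟶ Z₃}
  {a : X₁ ⟶ X₂} {b : X₂ ⟶ X₃} {c : Z₁ ⟶ Z₂} {d : Z₂ ⟶ Z₃}

lemma epi_middle (hX : IsSES a b) (hZ : IsSES c d) (wa : a ≫ φ₂ = φ₁ ≫ c)
    (wb : b ≫ φ₃ = φ₂ ≫ d) [Epi φ₁] [Epi φ₃] : Epi φ₂ :=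
  have : Epi (ShortComplex.mk a b hX.w).g := hX.epi
  have : Epi (ShortComplex.mk c d hZ.w).g := hZ.epi
  ShortComplex.epi_τ₂_of_exact_of_epi (S₁ := .mk a b hX.w) (S₂ := .mk c d hZ.w)
    ⟨φ₁, φ₂, φ₃, wa.symm, wb.symm⟩ hZ.2.exact

/-- The kernels of an epimorphism between short exact sequences form a short exact sequence. -/
lemma exists_kernels (hX : IsSES a b) (hZ : IsSES c d) (h₁ : IsSES k₁ φ₁) (h₂ : IsSES k₂ φ₂)
    (h₃ : IsSES k₃ φ₃) (wa : a ≫ φ₂ = φ₁ ≫ c) (wb : b ≫ φ₃ = φ₂ ≫ d) :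
    ∃ (e : K₁ ⟶ K₂) (f : K₂ ⟶ K₃), IsSES e f := by
  have := hX.mono
  have := hX.epi
  have := hZ.mono
  have := h₁.mono
  have := h₁.epi
  have := h₂.mono
  have := h₃.mono
  obtain ⟨e, he⟩ := h₂.exists_lift (k₁ ≫ a) (by rw [Category.assoc, wa, reassoc_of% h₁.w, zero_comp])
  obtain ⟨f, hf⟩ := h₃.exists_lift (k₂ ≫ b) (by rw [Category.assoc, wb, reassoc_of% h₂.w, zero_comp])
  have : Mono (e ≫ k₂) := he ▸ mono_comp _ _
  have : Mono e := mono_of_mono e k₂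
  have : Epi f := by
    rw [epi_iff_surjective_up_to_refinements]
    intro T x
    obtain ⟨T', p, _, y, hy⟩ := surjective_up_to_refinements_of_epi b (x ≫ k₃)
    obtain ⟨z, hz⟩ := hZ.exists_lift (y ≫ φ₂) (by
      rw [Category.assoc, ← wb, ← reassoc_of% hy, h₃.w, comp_zero, comp_zero])
    obtain ⟨T'', q, _, t, ht⟩ := surjective_up_to_refinements_of_epi φ₁ z
    obtain ⟨s, hs⟩ := h₂.exists_lift (q ≫ y - t ≫ a) (by
      simp only [Preadditive.sub_comp, Category.assoc, wa]
      rw [← reassoc_of% ht, hz, sub_self])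
    refine ⟨T'', q ≫ p, epi_comp _ _, s, ?_⟩
    rw [← cancel_mono k₃, Category.assoc, Category.assoc, Category.assoc, hf, reassoc_of% hs,
      Preadditive.sub_comp, Category.assoc, Category.assoc, hX.w, comp_zero, sub_zero, ← hy]
  refine ⟨e, f, of_exists_lift ?_ fun T k hk => ?_⟩
  · rw [← cancel_mono k₃, Category.assoc, hf, reassoc_of% he, hX.w, comp_zero, zero_comp]
  · obtain ⟨x, hx⟩ := hX.exists_lift (k ≫ k₂) (by
      rw [Category.assoc, ← hf, reassoc_of% hk, zero_comp])
    obtain ⟨l, hl⟩ := h₁.exists_lift x (by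
      rw [← cancel_mono c, Category.assoc, ← wa, reassoc_of% hx, h₂.w, comp_zero, zero_comp])
    exact ⟨l, by rw [← cancel_mono k₂, Category.assoc, he, reassoc_of% hl, hx]⟩

end Snake

section CoSnake

variable {Z₁ Z₂ Z₃ X₁ X₂ X₃ Q₁ Q₂ Q₃ : A}
  {φ₁ : Z₁ ⟶ X₁} {φ₂ : Z₂ ⟶ X₂} {φ₃ : Z₃ ⟶ X₃} {q₁ : X₁ ⟶ Q₁} {q₂ : X₂ ⟶ Q₂} {q₃ : X₃ ⟶ Q₃}
  {a : X₁ ⟶ X₂} {b : X₂ ⟶ X₃} {c : Z₁ ⟶ Z₂} {d : Z₂ ⟶ Z₃}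

lemma mono_middle (hX : IsSES a b) (hZ : IsSES c d) (wa : c ≫ φ₂ = φ₁ ≫ a)
    (wb : d ≫ φ₃ = φ₂ ≫ b) [Mono φ₁] [Mono φ₃] : Mono φ₂ :=
  have := hZ.mono
  have := hX.mono
  ShortComplex.mono_τ₂_of_exact_of_mono (S₁ := .mk c d hZ.w) (S₂ := .mk a b hX.w)
    ⟨φ₁, φ₂, φ₃, wa.symm, wb.symm⟩ hZ.2.exact

/-- The cokernels of a monomorphism between short exact sequences form a short exact sequence. -/
lemma exists_cokernels (hX : IsSES a b) (hZ : IsSES c d) (h₁ : IsSES φ₁ q₁) (h₂ : IsSES φ₂ q₂)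
    (h₃ : IsSES φ₃ q₃) (wa : c ≫ φ₂ = φ₁ ≫ a) (wb : d ≫ φ₃ = φ₂ ≫ b) :
    ∃ (e : Q₁ ⟶ Q₂) (f : Q₂ ⟶ Q₃), IsSES e f := by
  obtain ⟨e, f, h⟩ := exists_kernels hX.op hZ.op h₃.op h₂.op h₁.op
    (by rw [← op_comp, ← op_comp, wb]) (by rw [← op_comp, ← op_comp, wa])
  exact ⟨_, _, h.unop⟩

end CoSnake

section Ext

variable [HasExt.{w} A]

lemma exists_extension (h : IsSES f g) {T : A} (hT : Subsingleton (Ext Z T 1)) (k : X ⟶ T) :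
    ∃ l : Y ⟶ T, f ≫ l = k := by
  obtain ⟨l, hl⟩ := Ext.contravariant_sequence_exact₁ h.2 T (Ext.mk₀ k) (add_zero 1)
    (Subsingleton.elim (α := Ext Z T 1) _ _)
  obtain ⟨l, rfl⟩ := Ext.mk₀_bijective _ _ |>.2 l
  exact ⟨l, Ext.mk₀_bijective _ _ |>.1 (by simpa using hl)⟩

lemma exists_lifting (h : IsSES f g) {T : A} (hT : Subsingleton (Ext T X 1)) (k : T ⟶ Z) :
    ∃ l : T ⟶ Y, l ≫ g = k := by
  obtain ⟨l, hl⟩ := Ext.covariant_sequence_exact₃ T h.2 (Ext.mk₀ k) (zero_add 1)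
    (Subsingleton.elim (α := Ext T X 1) _ _)
  obtain ⟨l, rfl⟩ := Ext.mk₀_bijective _ _ |>.2 l
  exact ⟨l, Ext.mk₀_bijective _ _ |>.1 (by simpa using hl)⟩

lemma ext_one_of_exists_extension (h : IsSES f g) [Projective Y] {T : A}
    (hT : ∀ k : X ⟶ T, ∃ l : Y ⟶ T, f ≫ l = k) : Subsingleton (Ext Z T 1) := by
  refine ⟨fun x y => ?_⟩
  suffices ∀ x : Ext Z T 1, x = 0 by rw [this x, this y]
  intro x
  obtain ⟨k, rfl⟩ := Ext.contravariant_sequence_exact₃ h.2 T x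
    (Ext.eq_zero_of_projective _) (add_zero 1)
  obtain ⟨k, rfl⟩ := Ext.mk₀_bijective _ _ |>.2 k
  obtain ⟨l, rfl⟩ := hT k
  rw [← Ext.mk₀_comp_mk₀]
  exact h.2.extClass_comp_assoc _

lemma ext_src_middle (h : IsSES f g) {T : A} {n : ℕ} (h₁ : Subsingleton (Ext X T n))
    (h₃ : Subsingleton (Ext Z T n)) : Subsingleton (Ext Y T n) := by
  refine ⟨fun x y => ?_⟩
  suffices ∀ x : Ext Y T n, x = 0 by rw [this x, this y]
  intro x
  obtain ⟨k, rfl⟩ := Ext.contravariant_sequence_exact₂ h.2 T x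
    (Subsingleton.elim (α := Ext X T n) _ _)
  rw [Subsingleton.elim (α := Ext Z T n) k 0, Ext.comp_zero]

lemma ext_tgt_middle (h : IsSES f g) {T : A} {n : ℕ} (h₁ : Subsingleton (Ext T X n))
    (h₃ : Subsingleton (Ext T Z n)) : Subsingleton (Ext T Y n) := by
  refine ⟨fun x y => ?_⟩
  suffices ∀ x : Ext T Y n, x = 0 by rw [this x, this y]
  intro x
  obtain ⟨k, rfl⟩ := Ext.covariant_sequence_exact₂ T h.2 x
    (Subsingleton.elim (α := Ext T Z n) _ _)
  rw [Subsingleton.elim (α := Ext T X n) k 0, Ext.zero_comp]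

lemma ext_tgt_right (h : IsSES f g) {T : A} {n : ℕ} (h₁ : Subsingleton (Ext T X (n + 1)))
    (h₂ : Subsingleton (Ext T Y n)) : Subsingleton (Ext T Z n) := by
  refine ⟨fun x y => ?_⟩
  suffices ∀ x : Ext T Z n, x = 0 by rw [this x, this y]
  intro x
  obtain ⟨k, rfl⟩ := Ext.covariant_sequence_exact₃ T h.2 x rfl
    (Subsingleton.elim (α := Ext T X (n + 1)) _ _)
  rw [Subsingleton.elim (α := Ext T Y n) k 0, Ext.zero_comp]

lemma ext_succ (h : IsSES f g) [Projective Y] {T : A} {n : ℕ}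
    (h₁ : Subsingleton (Ext X T n)) : Subsingleton (Ext Z T (n + 1)) := by
  refine ⟨fun x y => ?_⟩
  suffices ∀ x : Ext Z T (n + 1), x = 0 by rw [this x, this y]
  intro x
  obtain ⟨k, rfl⟩ := Ext.contravariant_sequence_exact₃ h.2 T x
    (Ext.eq_zero_of_projective _) (add_comm 1 n)
  rw [Subsingleton.elim (α := Ext X T n) k 0, Ext.comp_zero]

end Ext

end IsSES

section Gorenstein

lemma isSES_image {X Y Z W : A} {d : X ⟶ Y} {d' : Y ⟶ Z} (w : d ≫ d' = 0)
    (h : (ShortComplex.mk d d' w).Exact) (e : W ≅ image d) :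
    IsSES (e.hom ≫ Limits.image.ι d) (factorThruImage d') := by
  have w' : Limits.image.ι d ≫ factorThruImage d' = 0 := by
    rw [← cancel_mono (Limits.image.ι d'), ← cancel_epi (factorThruImage d)]
    simp [w]
  refine .of_exists_lift (by rw [Category.assoc, w', comp_zero]) fun T k hk => ?_
  have hk' : k ≫ d' = 0 := by rw [← Limits.image.fac d', reassoc_of% hk, zero_comp]
  obtain ⟨T', q, _, y, hy⟩ := h.exact_up_to_refinements k hk'
  have hc : k ≫ cokernel.π (Limits.image.ι d) = 0 := by
    have hc' : d ≫ cokernel.π (Limits.image.ι d) = 0 := by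
      have := Limits.image.fac d =≫ cokernel.π (Limits.image.ι d)
      rwa [Category.assoc, cokernel.condition, comp_zero, eq_comm] at this
    rw [← cancel_epi q, reassoc_of% hy, hc', comp_zero, comp_zero]
  obtain ⟨l, hl⟩ := (IsSES.of_mono (Limits.image.ι d)).exists_lift k hc
  exact ⟨l ≫ e.inv, by simpa using hl⟩

lemma exists_bisequence {α : Type*} (R : α → α → Prop) (hr : ∀ x, ∃ y, R x y)
    (hl : ∀ y, ∃ x, R x y) (a : α) : ∃ z : ℤ → α, z 1 = a ∧ ∀ n, R (z n) (z (n + 1)) := by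
  choose s hs using hr
  choose p hp using hl
  let z : ℤ → α := fun n => Int.rec (fun k => s^[k] a) (fun k => p^[k + 1] a) n
  have hz : ∀ n, R (z n) (z (n + 1)) := by
    rintro (k | k)
    · have : z (Int.ofNat k + 1) = s (z (Int.ofNat k)) :=
        Function.iterate_succ_apply' s k a
      rw [this]
      exact hs _
    · have hk : z (Int.negSucc k) = p (p^[k] a) := Function.iterate_succ_apply' p k a
      have : z (Int.negSucc k + 1) = p^[k] a := by
        cases k <;> rfl
      rw [hk, this]
      exact hp _
  refine ⟨fun n => z (n - 1), rfl, fun n => ?_⟩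
  have := hz (n - 1)
  rwa [show n - 1 + 1 = n + 1 - 1 by ring] at this

variable [HasExt.{w} A]

/-- A class `S` of objects, left orthogonal to `𝒞`, in which every object is both a kernel and
a cokernel of a map between an object of `𝒞` and an object of `S`. -/
structure IsGorensteinClass (𝒞 S : A → Prop) : Prop where
  ext : ∀ ⦃X⦄, S X → ∀ ⦃C⦄, 𝒞 C → Subsingleton (Ext X C 1)
  left : ∀ ⦃X⦄, S X → ∃ (X' C : A) (i : X' ⟶ C) (p : C ⟶ X), S X' ∧ 𝒞 C ∧ IsSES i p
  right : ∀ ⦃X⦄, S X → ∃ (C X' : A) (i : X ⟶ C) (p : C ⟶ X'), S X' ∧ 𝒞 C ∧ IsSES i p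

lemma projective_of_selfOrthogonal {𝒞 : A → Prop} (hso : SelfOrthogonal 𝒞)
    (hgen : ProjIsGeneratorFor 𝒞) {C : A} (hC : 𝒞 C) : Projective C := by
  obtain ⟨C', P, f, g, hP, hC', h⟩ := hgen hC
  obtain ⟨s, hs⟩ := h.exists_lifting (hso hC hC' 1 le_rfl) (𝟙 C)
  exact Retract.projective ⟨s, g, hs⟩

variable {𝒞 : A → Prop}

lemma IsGorensteinClass.isGorenstein (hproj : ∀ ⦃C : A⦄, 𝒞 C → Projective C)
    {S : A → Prop} (hS : IsGorensteinClass 𝒞 S) {M : A} (hM : S M) : IsGorenstein 𝒞 M := by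
  obtain ⟨z, hz₁, hz⟩ := exists_bisequence
    (fun X Y : Subtype S => ∃ (C : A) (i : X.1 ⟶ C) (p : C ⟶ Y.1), 𝒞 C ∧ IsSES i p)
    (fun X => let ⟨C, X', i, p, h, hC, hip⟩ := hS.right X.2; ⟨⟨X', h⟩, C, i, p, hC, hip⟩)
    (fun X => let ⟨X', C, i, p, h, hC, hip⟩ := hS.left X.2; ⟨⟨X', h⟩, C, i, p, hC, hip⟩)
    ⟨M, hM⟩
  choose X i p hX h using hz
  have hi n : Mono (i n) := (h n).mono
  have hp n : Epi (p n) := (h n).epi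
  refine ⟨X, fun n => p n ≫ i (n + 1), fun n => ?_, hX, fun n => ?_, fun n C hC k => ?_,
    fun n C hC k => ?_, ?_⟩
  · rw [Category.assoc, reassoc_of% (h (n + 1)).w, zero_comp, comp_zero]
  · let φ : ShortComplex.mk (p n ≫ i (n + 1)) (p (n + 1))
        (by rw [Category.assoc, (h (n + 1)).w, comp_zero]) ⟶
        ShortComplex.mk (i (n + 1)) (p (n + 1)) (h (n + 1)).w :=
      { τ₁ := p n, τ₂ := 𝟙 _, τ₃ := 𝟙 _ }
    let ψ : ShortComplex.mk (p n ≫ i (n + 1)) (p (n + 1))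
        (by rw [Category.assoc, (h (n + 1)).w, comp_zero]) ⟶
        ShortComplex.mk (p n ≫ i (n + 1)) (p (n + 1) ≫ i (n + 1 + 1))
          (by rw [Category.assoc, reassoc_of% (h (n + 1)).w, zero_comp, comp_zero]) :=
      { τ₁ := 𝟙 _, τ₂ := 𝟙 _, τ₃ := i (n + 1 + 1) }
    have : Epi φ.τ₁ := hp n
    have : IsIso φ.τ₂ := inferInstanceAs (IsIso (𝟙 _))
    have : Mono φ.τ₃ := inferInstanceAs (Mono (𝟙 _))
    have : Epi ψ.τ₁ := inferInstanceAs (Epi (𝟙 _))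
    have : IsIso ψ.τ₂ := inferInstanceAs (IsIso (𝟙 _))
    have : Mono ψ.τ₃ := hi (n + 1 + 1)
    exact (ShortComplex.exact_iff_of_epi_of_isIso_of_mono ψ).1
      ((ShortComplex.exact_iff_of_epi_of_isIso_of_mono φ).2 (h (n + 1)).2.exact)
  · have := hproj hC
    constructor
    · intro hk
      obtain ⟨l, rfl⟩ := (h (n + 1)).exists_lift k (by
        rw [← cancel_mono (i (n + 1 + 1)), Category.assoc, zero_comp]
        exact hk)
      exact ⟨Projective.factorThru l (p n), by simp⟩
    · rintro ⟨l, rfl⟩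
      simp [reassoc_of% (h (n + 1)).w]
  · constructor
    · intro hk
      obtain ⟨l, rfl⟩ := (h (n + 1)).exists_desc k (by
        rw [← cancel_epi (p n), comp_zero, ← Category.assoc]
        exact hk)
      obtain ⟨m, rfl⟩ := (h (n + 1 + 1)).exists_extension (hS.ext (z _).2 hC) l
      exact ⟨m, by simp⟩
    · rintro ⟨l, rfl⟩
      simp [reassoc_of% (h (n + 1)).w]
  · have : StrongEpi (p 0) := strongEpi_of_epi _
    have e : M ≅ (z (0 + 1)).1 := eqToIso (by rw [zero_add, hz₁])
    exact ⟨e ≪≫ (image.isoStrongEpiMono (p 0) (i (0 + 1)) rfl)⟩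

lemma isGorensteinClass_isGorenstein (hproj : ∀ ⦃C : A⦄, 𝒞 C → Projective C) :
    IsGorensteinClass 𝒞 (IsGorenstein 𝒞) := by
  suffices ∀ M, IsGorenstein 𝒞 M → ∃ S : A → Prop, S M ∧ IsGorensteinClass 𝒞 S by
    refine ⟨fun M hM => ?_, fun M hM => ?_, fun M hM => ?_⟩ <;>
      obtain ⟨S, hSM, hS⟩ := this M hM
    · exact hS.ext hSM
    · obtain ⟨X', C, i, p, hX', h⟩ := hS.left hSM
      exact ⟨X', C, i, p, hS.isGorenstein hproj hX', h⟩
    · obtain ⟨C, X', i, p, hX', h⟩ := hS.right hSM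
      exact ⟨C, X', i, p, hS.isGorenstein hproj hX', h⟩
  rintro M ⟨X, d, hw, hX, hd, -, hr, ⟨e⟩⟩
  have ses (n : ℤ) {W : A} (e : W ≅ image (d n)) := isSES_image (hw n) (hd n) e
  refine ⟨fun Y => ∃ n, Nonempty (Y ≅ image (d n)), ⟨0, ⟨e⟩⟩, ?_, ?_, ?_⟩
  · rintro Y ⟨n, ⟨e⟩⟩ C hC
    obtain ⟨n, rfl⟩ : ∃ m, n = m + 1 + 1 := ⟨n - 2, by ring⟩
    have := hproj (hX (n + 1 + 1))
    have hs : IsSES (Limits.image.ι (d (n + 1))) (factorThruImage (d (n + 1 + 1)) ≫ e.inv) := by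
      have h := ses (n + 1) (Iso.refl _)
      have := h.epi
      refine .of_exists_lift (by simpa using h.w =≫ e.inv) fun T k hk => ?_
      obtain ⟨l, hl⟩ := h.exists_lift k (by simpa using hk =≫ e.hom)
      exact ⟨l, by simpa using hl⟩
    refine hs.ext_one_of_exists_extension fun k => ?_
    obtain ⟨l, hl⟩ := (hr n hC (factorThruImage (d (n + 1)) ≫ k)).1 (by
      have := (ses n (Iso.refl _)).w
      dsimp only
      rw [← Limits.image.fac (d n), Category.assoc]
      simp only [Iso.refl_hom, Category.id_comp] at this
      rw [reassoc_of% this, zero_comp, comp_zero])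
    refine ⟨l, ?_⟩
    rw [← cancel_epi (factorThruImage (d (n + 1))), ← Category.assoc, Limits.image.fac]
    exact hl
  · rintro Y ⟨n, ⟨e⟩⟩
    obtain ⟨n, rfl⟩ : ∃ m, n = m + 1 := ⟨n - 1, by ring⟩
    have h := ses n (Iso.refl _)
    have := h.epi
    have := h.mono
    refine ⟨_, _, _, factorThruImage (d (n + 1)) ≫ e.inv, ⟨n, ⟨Iso.refl _⟩⟩, hX (n + 1),
      .of_exists_lift (f := (Iso.refl _).hom ≫ Limits.image.ι (d n))
        (by rw [← Category.assoc, h.w, zero_comp]) fun T k hk =>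
          h.exists_lift k (by simpa using hk =≫ e.hom)⟩
  · rintro Y ⟨n, ⟨e⟩⟩
    exact ⟨_, _, _, _, ⟨n + 1, ⟨Iso.refl _⟩⟩, hX (n + 1), ses n e⟩

/-- `𝒢(𝒞)` is closed under extensions. -/
lemma IsGorenstein.of_isSES (hproj : ∀ ⦃C : A⦄, 𝒞 C → Projective C)
    (hadd : IsAdditiveClosed 𝒞) {G₁ X G₂ : A} {a : G₁ ⟶ X} {b : X ⟶ G₂}
    (h : IsSES a b) (h₁ : IsGorenstein 𝒞 G₁) (h₂ : IsGorenstein 𝒞 G₂) : IsGorenstein 𝒞 X := by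
  have hG := isGorensteinClass_isGorenstein hproj
  refine IsGorensteinClass.isGorenstein hproj
    (S := fun X => ∃ (G₁ G₂ : A) (a : G₁ ⟶ X) (b : X ⟶ G₂),
      IsGorenstein 𝒞 G₁ ∧ IsGorenstein 𝒞 G₂ ∧ IsSES a b)
    ⟨?_, ?_, ?_⟩ ⟨_, _, a, b, h₁, h₂, h⟩
  · rintro X ⟨G₁, G₂, a, b, h₁, h₂, h⟩ C hC
    exact h.ext_src_middle (hG.ext h₁ hC) (hG.ext h₂ hC)
  · rintro X ⟨G₁, G₂, a, b, h₁, h₂, h⟩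
    obtain ⟨K₁, C₁, i₁, p₁, hK₁, hC₁, hs₁⟩ := hG.left h₁
    obtain ⟨K₂, C₂, i₂, p₂, hK₂, hC₂, hs₂⟩ := hG.left h₂
    have := h.epi
    have := hs₁.epi
    have := hs₂.epi
    have := hproj hC₂
    have wa : biprod.inl ≫ biprod.desc (p₁ ≫ a) (Projective.factorThru p₂ b) = p₁ ≫ a := by simp
    have wb : biprod.snd ≫ p₂ = biprod.desc (p₁ ≫ a) (Projective.factorThru p₂ b) ≫ b := by
      ext <;> simp [h.w]
    have := IsSES.epi_middle (.biprod C₁ C₂) h wa wb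
    obtain ⟨e, f, hef⟩ := IsSES.exists_kernels (.biprod C₁ C₂) h hs₁ (.of_epi _) hs₂ wa wb
    exact ⟨_, _, _, _, ⟨_, _, e, f, hK₁, hK₂, hef⟩, hadd.2.2 hC₁ hC₂, .of_epi _⟩
  · rintro X ⟨G₁, G₂, a, b, h₁, h₂, h⟩
    obtain ⟨C₁, K₁, i₁, p₁, hK₁, hC₁, hs₁⟩ := hG.right h₁
    obtain ⟨C₂, K₂, i₂, p₂, hK₂, hC₂, hs₂⟩ := hG.right h₂
    have := hs₁.mono
    have := hs₂.mono
    obtain ⟨t, ht⟩ := h.exists_extension (hG.ext h₂ hC₁) i₁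
    have wa : a ≫ biprod.lift t (b ≫ i₂) = i₁ ≫ biprod.inl := by
      ext <;> simp [ht, reassoc_of% h.w]
    have wb : b ≫ i₂ = biprod.lift t (b ≫ i₂) ≫ biprod.snd := by simp
    have := IsSES.mono_middle (.biprod C₁ C₂) h wa wb
    obtain ⟨e, f, hef⟩ := IsSES.exists_cokernels (.biprod C₁ C₂) h hs₁ (.of_mono _) hs₂ wa wb
    exact ⟨_, _, _, _, ⟨_, _, e, f, hK₁, hK₂, hef⟩, hadd.2.2 hC₁ hC₂, .of_mono _⟩

/-- The cokernel of a monomorphism between objects of `𝒢(𝒞)^{⊥1}` lies in `𝒢(𝒞)^{⊥1}`. -/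
lemma RightPerp1.of_isSES (hproj : ∀ ⦃C : A⦄, 𝒞 C → Projective C)
    {X Y Z : A} {f : X ⟶ Y} {g : Y ⟶ Z} (h : IsSES f g)
    (hX : RightPerp1 𝒞 X) (hY : RightPerp1 𝒞 Y) : RightPerp1 𝒞 Z := by
  intro G hG
  obtain ⟨K, C, i, p, hK, hC, hs⟩ := (isGorensteinClass_isGorenstein hproj).left hG
  have := hproj hC
  exact h.ext_tgt_right (hs.ext_succ (hX hK)) (hY hG)

end Gorenstein

/-- assume `𝒞` is a generator for `𝒢(𝒞)^{⊥1}`. Given a `Hom(𝒞,-)`-exact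
short exact sequence `0 ⟶ L ⟶ M ⟶ N ⟶ 0` with `L` and `M` admitting special
`𝒢(𝒞)`-precovers, and a `Hom(𝒞,-)`-exact short exact sequence `0 ⟶ K ⟶ C ⟶ N ⟶ 0`
with `C ∈ 𝒞`, the object `N` admits a special `𝒢(𝒞)`-precover. -/
theorem stmt_17 [HasExt.{w} A] (𝒞 : A → Prop) (hadd : IsAdditiveClosed 𝒞)
    (hso : SelfOrthogonal 𝒞) (hgen : ProjIsGeneratorFor 𝒞)
    (hCgen : GeneratorForPerp 𝒞)
    {L M N : A} (f : L ⟶ M) (g : M ⟶ N) (hses : IsSES f g)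
    (hlex : HomLeftExact 𝒞 f g)
    (hL : HasSpecialPrecover 𝒞 L) (hM : HasSpecialPrecover 𝒞 M)
    (hN : ∃ (K C : A) (u : K ⟶ C) (v : C ⟶ N),
      𝒞 C ∧ IsSES u v ∧ HomLeftExact 𝒞 u v) :
    HasSpecialPrecover 𝒞 N := by
  have hproj : ∀ ⦃C : A⦄, 𝒞 C → Projective C := fun C hC =>
    projective_of_selfOrthogonal hso hgen hC
  have hG := isGorensteinClass_isGorenstein hproj
  obtain ⟨G₁, π₁, hG₁, _, hK₁, -⟩ := hL
  obtain ⟨G₂, π₂, hG₂, _, hK₂, hlift⟩ := hM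
  obtain ⟨α, hα : α ≫ π₂ = π₁ ≫ f⟩ := hlift hG₁ (π₁ ≫ f)
  obtain ⟨C, G', i, p, hG', hC, hip⟩ := hG.right hG₁
  have := hip.mono
  have := hses.epi
  have : Mono (biprod.lift α i ≫ biprod.snd) := by simpa
  have : Mono (biprod.lift α i) := mono_of_mono _ biprod.snd
  have hQ := IsSES.of_mono (biprod.lift α i)
  obtain ⟨_, _, hext⟩ := IsSES.exists_cokernels (.biprod G₂ C) (.id_right G₁) (.id_right G₂) hQ hip
    (by simp) (by simp)
  have hGQ : IsGorenstein 𝒞 (cokernel (biprod.lift α i)) := .of_isSES hproj hadd hext hG₂ hG'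
  have hE : IsSES (biprod.map (kernel.ι π₂) (𝟙 C)) (biprod.desc π₂ 0) := by
    have : Epi (biprod.inl ≫ biprod.desc π₂ (0 : C ⟶ M)) := by simpa
    have : Epi (biprod.desc π₂ (0 : C ⟶ M)) := epi_of_epi biprod.inl _
    refine .of_exists_lift (by ext <;> simp) fun T k hk => ?_
    have hk' : (k ≫ biprod.fst) ≫ π₂ = 0 := by simpa [biprod.desc_eq] using hk
    exact ⟨biprod.lift (kernel.lift π₂ _ hk') (k ≫ biprod.snd), by ext <;> simp⟩
  obtain ⟨q, hq⟩ := hQ.exists_desc (biprod.desc π₂ 0 ≫ g) (by simp [reassoc_of% hα, hses.w])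
  have := hE.epi
  have : Epi (cokernel.π (biprod.lift α i) ≫ q) := hq ▸ epi_comp _ _
  have : Epi q := epi_of_epi (cokernel.π (biprod.lift α i)) q
  obtain ⟨_, _, hker⟩ := IsSES.exists_kernels hQ hses (.of_epi π₁) hE (.of_epi q)
    (by simp [hα]) hq
  have hperp : RightPerp1 𝒞 (kernel q) := .of_isSES hproj hker hK₁ fun G hGG =>
    (IsSES.biprod _ C).ext_tgt_middle (hK₂ hGG) (hG.ext hGG hC)
  exact ⟨_, q, hGQ, inferInstance, hperp, fun G hGG k =>
    (IsSES.of_epi q).exists_lifting (hperp hGG) k⟩
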